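/- For every m ≥ 1, the formula (⋀_{i ≤ m} Nⁱ p) → □p (where Nⁱ denotes i-fold application of N and □φ abbreviates ¬(⊤ U ¬φ)) does not belong to LTL; consequently LTL_NT(m) is not a subset of LTL. -/

import Mathlib

/-- LTL formulas: letters, falsum, implication, Next, Until.
Other Boolean connectives are defined as abbreviations. -/
inductive Fml : Type
  | letter : ℕ → Fml
  | bot : Fml
  | imp : Fml → Fml → Fml
  | next : Fml → Fml
  | untl : Fml → Fml → Fml
deriving DecidableEq

namespace Fml
def neg (φ : Fml) : Fml := imp φ bot
def top : Fml := neg bot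
def conj (φ ψ : Fml) : Fml := neg (imp φ (neg ψ))
def disj (φ ψ : Fml) : Fml := imp (neg φ) ψ
/-- □φ abbreviates ¬(⊤ U ¬φ). -/
def box (φ : Fml) : Fml := neg (untl top (neg φ))
end Fml

/-- Truth in a model on the non-transitive linear frame determined by `t : ℕ → ℕ`:
`φ U ψ` at `a` looks only as far as `t a`. -/
def sat (t : ℕ → ℕ) (V : ℕ → Set ℕ) : Fml → ℕ → Prop
  | .letter p, a => a ∈ V p
  | .bot, _ => False
  | .imp φ ψ, a => sat t V φ a → sat t V ψ a
  | .next φ, a => sat t V φ (a + 1)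
  | .untl φ ψ, a => ∃ b, a ≤ b ∧ b ≤ t a ∧ sat t V ψ b ∧ ∀ c, a ≤ c → c < b → sat t V φ c

/-- A non-transitive linear frame: `t i > i` and `t` is increasing on successive points. -/
def NTFrame (t : ℕ → ℕ) : Prop := (∀ i, i < t i) ∧ (∀ i, t i < t (i + 1))

/-- The logic LTL_NT. -/
def LTLNT : Set Fml := {φ | ∀ t, NTFrame t → ∀ V a, sat t V φ a}

/-- Standard LTL semantics on ⟨ℕ, ≤, Next⟩. -/
def satStd (V : ℕ → Set ℕ) : Fml → ℕ → Prop
  | .letter p, a => a ∈ V p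
  | .bot, _ => False
  | .imp φ ψ, a => satStd V φ a → satStd V ψ a
  | .next φ, a => satStd V φ (a + 1)
  | .untl φ ψ, a => ∃ b, a ≤ b ∧ satStd V ψ b ∧ ∀ c, a ≤ c → c < b → satStd V φ c

/-- The standard linear temporal logic LTL. -/
def LTL : Set Fml := {φ | ∀ V a, satStd V φ a}

/-- The logic LTL_NT(m) of uniform intransitivity `m` (frame with `t i = i + m`). -/
def LTLNTm (m : ℕ) : Set Fml := {φ | ∀ V a, sat (· + m) V φ a}

/-- An inference rule: a finite list of premises and a conclusion. -/
structure Rule where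
  prem : List Fml
  concl : Fml

/-- A rule is valid in a model iff truth of all premises at all points implies
truth of the conclusion at all points. -/
def validInModel (t : ℕ → ℕ) (V : ℕ → Set ℕ) (r : Rule) : Prop :=
  (∀ φ ∈ r.prem, ∀ a, sat t V φ a) → ∀ a, sat t V r.concl a

/-- A rule is valid in a frame iff it is valid in every model on it. -/
def validInFrame (t : ℕ → ℕ) (r : Rule) : Prop := ∀ V, validInModel t V r

/-- Size of a formula. -/
def Fml.size : Fml → ℕ
  | .letter _ => 1
  | .bot => 1
  | .imp φ ψ => φ.size + ψ.size + 1
  | .next φ => φ.size + 1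
  | .untl φ ψ => φ.size + ψ.size + 1

/-- Size of a rule. -/
def Rule.size (r : Rule) : ℕ := (r.prem.map Fml.size).sum + r.concl.size

/-- An injective encoding of formulas into ℕ (to speak about computability). -/
def encF : Fml → ℕ
  | .letter p => Nat.pair 0 p
  | .bot => Nat.pair 1 0
  | .imp φ ψ => Nat.pair 2 (Nat.pair (encF φ) (encF ψ))
  | .next φ => Nat.pair 3 (encF φ)
  | .untl φ ψ => Nat.pair 4 (Nat.pair (encF φ) (encF ψ))

def encL : List Fml → ℕ
  | [] => 0
  | φ :: l => Nat.pair (encF φ) (encL l) + 1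

/-- An injective encoding of rules into ℕ. -/
def encRule (r : Rule) : ℕ := Nat.pair (encL r.prem) (encF r.concl)

/-- A literal: `φ` or `¬φ` according to a Boolean flag (`α⁰ = α`, `α¹ = ¬α`). -/
def lit (b : Bool) (φ : Fml) : Fml := if b then φ else φ.neg

/-- Conjunction of a list of formulas. -/
def bigConj : List Fml → Fml
  | [] => Fml.top
  | φ :: l => (bigConj l).conj φ

/-- Disjunction of a list of formulas. -/
def bigDisj : List Fml → Fml
  | [] => Fml.bot
  | φ :: l => (bigDisj l).disj φ

/-- The premise of a rule in reduced normal form: a disjunction over `j < l` of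
conjunctions of literals over `xᵢ`, `N xᵢ` (for `i < n`) and `xᵢ U x_k` (for `i ≠ k`). -/
def rnfPremise (n l : ℕ) (t0 t1 : Fin l → Fin n → Bool)
    (t2 : Fin l → Fin n → Fin n → Bool) : Fml :=
  bigDisj ((List.finRange l).map fun j =>
    bigConj ((List.finRange n).map (fun i => lit (t0 j i) (.letter i)) ++
      (List.finRange n).map (fun i => lit (t1 j i) (.next (.letter i))) ++
      ((List.finRange n).flatMap fun i =>
        ((List.finRange n).filter (fun k => k ≠ i)).map fun k =>
          lit (t2 j i k) (.untl (.letter i) (.letter k))))) 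

/-- `IsRNF n l r`: the rule `r` is in reduced normal form with `n` letters and
`l` disjuncts, i.e. of the shape `ε / x₁`. -/
def IsRNF (n l : ℕ) (r : Rule) : Prop :=
  0 < n ∧ 0 < l ∧ r.concl = .letter 0 ∧
    ∃ t0 t1 t2, r.prem = [rnfPremise n l t0 t1 t2]

/-- Next relation of the finite frame ℱ(N(r)): it wraps the last point `T` to `g`. -/
def wNext (T g : ℕ) (a : ℕ) : ℕ := if a = T then g else a + 1

/-- Truth in a model on the finite frame `ℱ(N(r))` obtained from the frame of `t`:
the base set is `[0, t^[r+1] 0]`, `T = t^[r+1] 0` is the last point, whose `Next` is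
`G = t^[g] 0`; `until` from `a` follows `wNext` for at most `t a - a` steps, so on the
last interval it acts as if the interval following it were `[t^[g] 0, t^[g+1] 0]`. -/
def satFin (t : ℕ → ℕ) (T G : ℕ) (V : ℕ → Set ℕ) : Fml → ℕ → Prop
  | .letter p, a => a ∈ V p
  | .bot, _ => False
  | .imp φ ψ, a => satFin t T G V φ a → satFin t T G V ψ a
  | .next φ, a => satFin t T G V φ (wNext T G a)
  | .untl φ ψ, a => ∃ k, k ≤ t a - a ∧ satFin t T G V ψ ((wNext T G)^[k] a) ∧
      ∀ j < k, satFin t T G V φ ((wNext T G)^[j] a)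

/-- `r` is refuted by `V` in the finite frame `ℱ(N(rr))` (with parameter `g`) built
from the frame of `t`: all premises hold at every point of the frame, while the
conclusion fails at some point. -/
def refutedFin (t : ℕ → ℕ) (rr g : ℕ) (V : ℕ → Set ℕ) (r : Rule) : Prop :=
  (∀ φ ∈ r.prem, ∀ a ≤ t^[rr + 1] 0, satFin t (t^[rr + 1] 0) (t^[g] 0) V φ a) ∧
    ∃ a ≤ t^[rr + 1] 0, ¬ satFin t (t^[rr + 1] 0) (t^[g] 0) V r.concl a

/-- Temporal degree: maximal nesting depth of `N` and `U`. -/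
def tdeg : Fml → ℕ
  | .letter _ => 0
  | .bot => 0
  | .imp φ ψ => max (tdeg φ) (tdeg ψ)
  | .next φ => tdeg φ + 1
  | .untl φ ψ => max (tdeg φ) (tdeg ψ) + 1

/-- `i`-fold application of `N`. -/
def nPow : ℕ → Fml → Fml
  | 0, φ => φ
  | k + 1, φ => .next (nPow k φ)

/-- Substitution of formulas for letters. -/
def subst (σ : ℕ → Fml) : Fml → Fml
  | .letter p => σ p
  | .bot => .bot
  | .imp φ ψ => .imp (subst σ φ) (subst σ ψ)
  | .next φ => .next (subst σ φ)
  | .untl φ ψ => .untl (subst σ φ) (subst σ ψ)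

/-- A rule is admissible in a logic `L` iff every substitution making all premises
theorems of `L` makes the conclusion a theorem of `L`. -/
def Admissible (L : Set Fml) (r : Rule) : Prop :=
  ∀ σ : ℕ → Fml, (∀ φ ∈ r.prem, subst σ φ ∈ L) → subst σ r.concl ∈ L

theorem sat_bigConj (t : ℕ → ℕ) (V : ℕ → Set ℕ) (a : ℕ) (l : List Fml) :
    sat t V (bigConj l) a ↔ ∀ φ ∈ l, sat t V φ a := by
  induction l with
  | nil => simp [bigConj, Fml.top, Fml.neg, sat]
  | cons φ l ih =>
    simp only [bigConj, Fml.conj, Fml.neg, sat, List.forall_mem_cons, ih]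
    tauto

theorem satStd_bigConj (V : ℕ → Set ℕ) (a : ℕ) (l : List Fml) :
    satStd V (bigConj l) a ↔ ∀ φ ∈ l, satStd V φ a := by
  induction l with
  | nil => simp [bigConj, Fml.top, Fml.neg, satStd]
  | cons φ l ih =>
    simp only [bigConj, Fml.conj, Fml.neg, satStd, List.forall_mem_cons, ih]
    tauto

theorem sat_nPow (t : ℕ → ℕ) (V : ℕ → Set ℕ) (φ : Fml) (i a : ℕ) :
    sat t V (nPow i φ) a ↔ sat t V φ (a + i) := by
  induction i generalizing a with
  | zero => simp [nPow]
  | succ k ih =>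
    simp only [nPow, sat, ih]
    rw [show a + 1 + k = a + (k + 1) by omega]

theorem satStd_nPow (V : ℕ → Set ℕ) (φ : Fml) (i a : ℕ) :
    satStd V (nPow i φ) a ↔ satStd V φ (a + i) := by
  induction i generalizing a with
  | zero => simp [nPow]
  | succ k ih =>
    simp only [nPow, satStd, ih]
    rw [show a + 1 + k = a + (k + 1) by omega]

/-- for every m ≥ 1, (⋀_{i ≤ m} Nⁱ p) → □p is not in LTL;
consequently LTL_NT(m) ⊄ LTL. -/
theorem stmt12 (m : ℕ) (hm : 1 ≤ m) :
    ((bigConj ((List.range (m + 1)).map fun i => nPow i (.letter 0))).imp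
        (Fml.letter 0).box) ∉ LTL ∧
      ¬ LTLNTm m ⊆ LTL := by
  have h1 : ((bigConj ((List.range (m + 1)).map fun i => nPow i (.letter 0))).imp
        (Fml.letter 0).box) ∉ LTL := by
    intro h
    have h2 := h (fun _ => {x | x ≤ m}) 0
    simp only [satStd, satStd_bigConj, Fml.box, Fml.neg, Fml.top] at h2
    refine h2 ?_ ⟨m + 1, by omega, ?_, fun _ _ _ h => h⟩
    · intro φ hφ
      obtain ⟨i, hi, rfl⟩ := List.mem_map.1 hφ
      rw [satStd_nPow]
      have := List.mem_range.1 hi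
      change 0 + i ≤ m
      omega
    · intro h3
      change m + 1 ≤ m at h3
      omega
  refine ⟨h1, fun hsub => h1 (hsub ?_)⟩
  intro V a
  simp only [sat, sat_bigConj, Fml.box, Fml.neg, Fml.top]
  rintro hall ⟨b, hab, hbm, hb, -⟩
  apply hb
  have h4 := hall (nPow (b - a) (.letter 0))
    (List.mem_map.2 ⟨b - a, List.mem_range.2 (by omega), rfl⟩)
  rw [sat_nPow, show a + (b - a) = b by omega] at h4
  exact h4
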